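/- Let d ≥ 3, v : ℝ^d → ℝ bounded measurable with bounded support, Y_x(t) = ∫₀^t v(W_x(s)) ds. Suppose |x_n| → ∞ and t_n → ∞. Then for every fixed α with |α| < α₀ (the threshold from Lemma 1), E[exp(α Y_{x_n}(t_n))] − 1 → 0 as n → ∞; equivalently if one interprets the empty path integral, E[exp(α Y_{x_n}(t_n))] converges to 1. -/

import Mathlib

open MeasureTheory Real Filter Topology ProbabilityTheory

noncomputable section

/-- Euclidean space `ℝ^d`. -/
abbrev Euc (d : ℕ) := EuclideanSpace ℝ (Fin d)

/-- The Brownian transition density `q(s; w) = (2πs)^{-d/2} exp(-|w|²/(2s))`. -/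
def heatKernel (d : ℕ) (s : ℝ) (w : Euc d) : ℝ :=
  (2 * π * s) ^ (-(d : ℝ) / 2) * Real.exp (-‖w‖ ^ 2 / (2 * s))

/-- Joint density of a Brownian motion started at `x`, at times `s 0 < s 1 < ⋯`. -/
def jointDensity (d : ℕ) {k : ℕ} (x : Euc d) (s : Fin k → ℝ) (z : Fin k → Euc d) : ℝ :=
  ∏ j : Fin k,
    heatKernel d (s j - if (j : ℕ) = 0 then 0 else s ⟨(j : ℕ) - 1, lt_of_le_of_lt (Nat.sub_le _ _) j.isLt⟩)
      (z j - if (j : ℕ) = 0 then x else z ⟨(j : ℕ) - 1, lt_of_le_of_lt (Nat.sub_le _ _) j.isLt⟩)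

/-- Joint density of the Brownian bridge from `a` to `b` in time `t`, at interior times `s`. -/
def bridgeDensity (d : ℕ) {k : ℕ} (t : ℝ) (a b : Euc d) (s : Fin k → ℝ) (z : Fin k → Euc d) : ℝ :=
  jointDensity d a (Fin.snoc s t) (Fin.snoc z b) / heatKernel d t (b - a)

/-- The open ordered simplex `0 < s₁ < ⋯ < s_k < t`. -/
def simplex (k : ℕ) (t : ℝ) : Set (Fin k → ℝ) :=
  {s | StrictMono s ∧ ∀ i, 0 < s i ∧ s i < t}

/-- `W` is a standard `d`-dimensional Brownian motion started at `x`, characterized by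
continuous paths and finite-dimensional densities given by products of heat kernels. -/
def IsBrownianMotion {Ω : Type*} [MeasureSpace Ω] {d : ℕ} (x : Euc d)
    (W : ℝ → Ω → Euc d) : Prop :=
  (∀ ω, W 0 ω = x) ∧ (∀ ω, Continuous fun s => W s ω) ∧
  ∀ (k : ℕ) (s : Fin (k + 1) → ℝ), StrictMono s → (∀ i, 0 < s i) →
    Measure.map (fun ω (i : Fin (k + 1)) => W (s i) ω) (ℙ : Measure Ω) =
      (volume : Measure (Fin (k + 1) → Euc d)).withDensity
        (fun z => ENNReal.ofReal (jointDensity d x s z))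

/-- `X` is a `d`-dimensional Brownian bridge from `a` to `b` in time `t`. -/
def IsBrownianBridge {Ω : Type*} [MeasureSpace Ω] {d : ℕ} (t : ℝ) (a b : Euc d)
    (X : ℝ → Ω → Euc d) : Prop :=
  (∀ ω, X 0 ω = a) ∧ (∀ ω, X t ω = b) ∧
  (∀ ω, ContinuousOn (fun s => X s ω) (Set.Icc 0 t)) ∧
  ∀ (k : ℕ) (s : Fin (k + 1) → ℝ), StrictMono s → (∀ i, 0 < s i ∧ s i < t) →
    Measure.map (fun ω (i : Fin (k + 1)) => X (s i) ω) (ℙ : Measure Ω) =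
      (volume : Measure (Fin (k + 1) → Euc d)).withDensity
        (fun z => ENNReal.ofReal (bridgeDensity d t a b s z))

/-- The path integral `∫₀^t v(X_s) ds`. -/
def pathInt {Ω : Type*} {d : ℕ} (v : Euc d → ℝ) (X : ℝ → Ω → Euc d) (t : ℝ) (ω : Ω) : ℝ :=
  ∫ s in Set.Ioc (0 : ℝ) t, v (X s ω)

/-- The total path integral `∫₀^∞ v(X_s) ds`. -/
def pathIntInf {Ω : Type*} {d : ℕ} (v : Euc d → ℝ) (X : ℝ → Ω → Euc d) (ω : Ω) : ℝ :=
  ∫ s in Set.Ioi (0 : ℝ), v (X s ω)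

/-- The density ratio `Q_{j} = q(t; y - x)/q(Δ_j s; Δ_j z)` with the conventions
`s₀ = 0`, `s_{k+1} = t`, `z₀ = x`, `z_{k+1} = y`. -/
def Qratio (d : ℕ) {k : ℕ} (t : ℝ) (x y : Euc d) (s : Fin k → ℝ) (z : Fin k → Euc d)
    (j : Fin (k + 1)) : ℝ :=
  heatKernel d t (y - x) /
    heatKernel d
      ((Fin.cons 0 (Fin.snoc s t) : Fin (k + 2) → ℝ) j.succ -
        (Fin.cons 0 (Fin.snoc s t) : Fin (k + 2) → ℝ) j.castSucc)
      ((Fin.cons x (Fin.snoc z y) : Fin (k + 2) → Euc d) j.succ -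
        (Fin.cons x (Fin.snoc z y) : Fin (k + 2) → Euc d) j.castSucc)

theorem lintegral_fin_cons {E : Type*} [MeasureSpace E] [SigmaFinite (volume : Measure E)] {k : ℕ}
    {F : (Fin (k + 1) → E) → ENNReal} (hF : Measurable F) :
    ∫⁻ z, F z = ∫⁻ a, ∫⁻ r, F (Fin.cons a r) := by
  have h := (volume_preserving_piFinSuccAbove (fun _ : Fin (k + 1) => E) 0).symm
  rw [← h.lintegral_comp hF, Measure.volume_eq_prod,
    lintegral_prod (fun p => F ((MeasurableEquiv.piFinSuccAbove (fun _ => E) 0).symm p))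
      (hF.comp (MeasurableEquiv.measurable _)).aemeasurable]
  simp [MeasurableEquiv.piFinSuccAbove, Fin.insertNthEquiv]

theorem heatKernel_pos (d : ℕ) {s : ℝ} (hs : 0 < s) (w : Euc d) : 0 < heatKernel d s w := by
  unfold heatKernel; positivity

@[fun_prop]
theorem measurable_heatKernel {β : Type*} [MeasurableSpace β] {d : ℕ} {s : β → ℝ} {w : β → Euc d}
    (hs : Measurable s) (hw : Measurable w) : Measurable fun b => heatKernel d (s b) (w b) := by
  unfold heatKernel; fun_prop

@[fun_prop]
theorem measurable_jointDensity {β : Type*} [MeasurableSpace β] {d k : ℕ} {x : β → Euc d}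
    {s : β → Fin k → ℝ} {z : β → Fin k → Euc d} (hx : Measurable x) (hs : Measurable s)
    (hz : Measurable z) : Measurable fun b => jointDensity d (x b) (s b) (z b) := by
  unfold jointDensity
  refine Finset.measurable_prod _ fun j _ => measurable_heatKernel ?_ ?_
  · split_ifs <;> fun_prop
  · split_ifs <;> fun_prop

theorem jointDensity_pos {d k : ℕ} (x : Euc d) {s : Fin k → ℝ} (hs : StrictMono s)
    (hs0 : ∀ i, 0 < s i) (z : Fin k → Euc d) : 0 < jointDensity d x s z := by
  refine Finset.prod_pos fun j _ => heatKernel_pos d ?_ _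
  split_ifs with h
  · simpa using hs0 j
  · exact sub_pos.2 (hs (Fin.mk_lt_of_lt_val (by omega)))

theorem jointDensity_cons {d k : ℕ} (x y : Euc d) (u : ℝ) (r : Fin k → ℝ) (z : Fin k → Euc d) :
    jointDensity d x (Fin.cons u (fun i => u + r i)) (Fin.cons y z) =
      heatKernel d u (y - x) * jointDensity d y r z := by
  unfold jointDensity
  rw [Fin.prod_univ_succ]
  congr 1
  · simp
  · refine Finset.prod_congr rfl fun j _ => ?_
    cases k with
    | zero => exact j.elim0
    | succ k =>
      refine Fin.cases ?_ (fun i => ?_) j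
      · simp
      · have h1 : (⟨(i.succ.succ : ℕ) - 1, lt_of_le_of_lt (Nat.sub_le _ _) i.succ.succ.isLt⟩ :
            Fin (k + 1 + 1)) = i.castSucc.succ := by ext; simp
        have h2 : (⟨(i.succ : ℕ) - 1, lt_of_le_of_lt (Nat.sub_le _ _) i.succ.isLt⟩ :
            Fin (k + 1)) = i.castSucc := by ext; simp
        rw [h1, h2]
        simp

/-- Strictly increasing `k`-tuples of times after `s`. -/
def increasingTimes (k : ℕ) (s : ℝ) : Set (Fin k → ℝ) :=
  {r | StrictMono r ∧ ∀ i, s < r i}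

theorem measurableSet_increasingTimes (k : ℕ) (s : ℝ) : MeasurableSet (increasingTimes k s) := by
  have : increasingTimes k s =
      (⋂ i, ⋂ j, ⋂ _ : i < j, {r | r i < r j}) ∩ ⋂ i, {r | s < r i} := by
    ext r; simp [increasingTimes, StrictMono]
  rw [this]
  refine MeasurableSet.inter ?_ ?_
  · exact .iInter fun i => .iInter fun j => .iInter fun _ =>
      measurableSet_lt (measurable_pi_apply i) (measurable_pi_apply j)
  · exact .iInter fun i => measurableSet_lt measurable_const (measurable_pi_apply i)

theorem cons_mem_increasingTimes {k : ℕ} {s u : ℝ} {r : Fin k → ℝ} :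
    (Fin.cons u r : Fin (k + 1) → ℝ) ∈ increasingTimes (k + 1) s ↔
      s < u ∧ r ∈ increasingTimes k u := by
  simp only [increasingTimes, Set.mem_ofPred_eq, Fin.strictMono_cons, Fin.forall_fin_succ (n := k),
    Fin.cons_zero, Fin.cons_succ]
  exact ⟨fun ⟨⟨h1, h2⟩, h3, _⟩ => ⟨h3, h2, h1⟩,
    fun ⟨h3, h2, h1⟩ => ⟨⟨h1, h2⟩, h3, fun i => h3.trans (h1 i)⟩⟩

theorem add_mem_increasingTimes {k : ℕ} {u : ℝ} {r : Fin k → ℝ} :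
    (fun i => u + r i) ∈ increasingTimes k u ↔ r ∈ increasingTimes k 0 := by
  simp [increasingTimes, StrictMono]

/-- Iterated integral of `g` over increasing `k`-tuples of times after `s`. -/
def iteratedTimeIntegral (g : ℝ → ENNReal) : ℕ → ℝ → ENNReal
  | 0, _ => 1
  | k + 1, s => ∫⁻ u in Set.Ioi s, g u * iteratedTimeIntegral g k u

theorem antitone_iteratedTimeIntegral (g : ℝ → ENNReal) (k : ℕ) :
    Antitone (iteratedTimeIntegral g k) := by
  intro s t hst
  cases k with
  | zero => exact le_rfl
  | succ k => exact lintegral_mono_set (Set.Ioi_subset_Ioi hst)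

theorem measurable_iteratedTimeIntegral (g : ℝ → ENNReal) (k : ℕ) :
    Measurable (iteratedTimeIntegral g k) :=
  (antitone_iteratedTimeIntegral g k).measurable

theorem lintegral_Ioi_mul_iteratedTimeIntegral {g : ℝ → ENNReal} (hg : Measurable g) (k : ℕ)
    (s : ℝ) : (∫⁻ u in Set.Ioi s, g u) * iteratedTimeIntegral g k s =
      (k + 1) * iteratedTimeIntegral g (k + 1) s := by
  induction k generalizing s with
  | zero => simp [iteratedTimeIntegral]
  | succ k ih =>
    set h : ℝ → ENNReal := fun u => g u * iteratedTimeIntegral g k u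
    have hhm : Measurable h := hg.mul (measurable_iteratedTimeIntegral g k)
    have hJ (s : ℝ) : iteratedTimeIntegral g (k + 1) s = ∫⁻ u in Set.Ioi s, h u := rfl
    have split : ∀ u ∈ Set.Ioi s, (∫⁻ w in Set.Ioi s, g w) * h u =
        (∫⁻ w in Set.Ioi u, g w) * h u + (∫⁻ w in Set.Ioo s u, g w) * h u := by
      intro u hu
      rw [← add_mul, ← Set.Ioc_union_Ioi_eq_Ioi (le_of_lt hu), lintegral_union measurableSet_Ioi
        (Set.Ioc_disjoint_Ioi le_rfl), setLIntegral_congr Ioo_ae_eq_Ioc, add_comm]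
    have above : ∫⁻ u in Set.Ioi s, (∫⁻ w in Set.Ioi u, g w) * h u =
        (k + 1) * iteratedTimeIntegral g (k + 2) s := by
      have hm : Measurable fun u => g u * iteratedTimeIntegral g (k + 1) u :=
        hg.mul (measurable_iteratedTimeIntegral g (k + 1))
      rw [iteratedTimeIntegral, ← lintegral_const_mul _ hm]
      refine lintegral_congr fun u => ?_
      rw [mul_left_comm, ih, mul_left_comm]
    have below : ∫⁻ u in Set.Ioi s, (∫⁻ w in Set.Ioo s u, g w) * h u =
        iteratedTimeIntegral g (k + 2) s := by
      let T : ℝ → ℝ → ENNReal := fun u w =>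
        {p : ℝ × ℝ | s < p.2 ∧ p.2 < p.1}.indicator (fun p => g p.2 * h p.1) (u, w)
      have hT : Measurable (Function.uncurry T) := by
        refine Measurable.indicator (by fun_prop) ?_
        exact (measurableSet_lt measurable_const measurable_snd).inter
          (measurableSet_lt measurable_snd measurable_fst)
      have h1 : ∫⁻ u in Set.Ioi s, (∫⁻ w in Set.Ioo s u, g w) * h u = ∫⁻ u, ∫⁻ w, T u w := by
        rw [← lintegral_indicator measurableSet_Ioi]
        refine lintegral_congr fun u => ?_
        by_cases hu : s < u
        · rw [Set.indicator_of_mem (show u ∈ Set.Ioi s from hu), ← lintegral_mul_const _ hg,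
            ← lintegral_indicator measurableSet_Ioo]
          rfl
        · rw [Set.indicator_of_notMem (show u ∉ Set.Ioi s from hu)]
          symm
          refine lintegral_eq_zero_of_ae_eq_zero (ae_of_all _ fun w => ?_)
          exact Set.indicator_of_notMem (fun hw => hu (hw.1.trans hw.2)) _
      rw [h1, lintegral_lintegral_swap hT.aemeasurable, iteratedTimeIntegral,
        ← lintegral_indicator measurableSet_Ioi]
      refine lintegral_congr fun w => ?_
      by_cases hw : s < w
      · rw [Set.indicator_of_mem (show w ∈ Set.Ioi s from hw), hJ, ← lintegral_const_mul _ hhm,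
          ← lintegral_indicator measurableSet_Ioi]
        refine lintegral_congr fun u => ?_
        simp [T, Set.indicator, hw]
      · rw [Set.indicator_of_notMem (show w ∉ Set.Ioi s from hw)]
        refine lintegral_eq_zero_of_ae_eq_zero (ae_of_all _ fun u => ?_)
        exact Set.indicator_of_notMem (fun hu => hw hu.1) _
    have hanti : Antitone fun u => ∫⁻ w in Set.Ioi u, g w :=
      fun _ _ h => lintegral_mono_set (Set.Ioi_subset_Ioi h)
    have hm : Measurable fun u => (∫⁻ w in Set.Ioi u, g w) * h u := hanti.measurable.mul hhm
    rw [hJ, ← lintegral_const_mul _ hhm, setLIntegral_congr_fun measurableSet_Ioi split,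
      lintegral_add_left hm, above, below]
    push_cast
    ring

theorem pow_lintegral_Ioi {g : ℝ → ENNReal} (hg : Measurable g) (k : ℕ) (s : ℝ) :
    (∫⁻ u in Set.Ioi s, g u) ^ k = k.factorial * iteratedTimeIntegral g k s := by
  induction k with
  | zero => simp [iteratedTimeIntegral]
  | succ k ih =>
    rw [pow_succ', ih, Nat.factorial_succ, Nat.cast_mul, mul_left_comm,
      lintegral_Ioi_mul_iteratedTimeIntegral hg]
    push_cast
    ring

theorem iteratedTimeIntegral_eq {g : ℝ → ENNReal} (hg : Measurable g) (k : ℕ) (s : ℝ) :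
    iteratedTimeIntegral g k s = ∫⁻ r in increasingTimes k s, ∏ i, g (r i) := by
  induction k generalizing s with
  | zero => 
    have : increasingTimes 0 s = Set.univ := by
      ext r; simp [increasingTimes, Subsingleton.strictMono]
    simp [iteratedTimeIntegral, this, volume_pi]
  | succ k ih =>
    rw [← lintegral_indicator (measurableSet_increasingTimes _ _), lintegral_fin_cons,
      iteratedTimeIntegral, ← lintegral_indicator measurableSet_Ioi]
    · refine lintegral_congr fun u => ?_
      by_cases hu : s < u
      · rw [Set.indicator_of_mem (show u ∈ Set.Ioi s from hu), ih,
          ← lintegral_const_mul _ (by fun_prop),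
          ← lintegral_indicator (measurableSet_increasingTimes _ _)]
        refine lintegral_congr fun r => ?_
        have := cons_mem_increasingTimes (s := s) (u := u) (r := r)
        by_cases hr : r ∈ increasingTimes k u
        · rw [Set.indicator_of_mem hr, Set.indicator_of_mem (this.2 ⟨hu, hr⟩), Fin.prod_univ_succ]
          simp
        · rw [Set.indicator_of_notMem hr, Set.indicator_of_notMem fun h => hr (this.1 h).2]
      · simp [Set.indicator, cons_mem_increasingTimes, hu]
    · exact Measurable.indicator (by fun_prop) (measurableSet_increasingTimes _ _)

theorem IsBrownianMotion.aemeasurable {Ω : Type*} [MeasureSpace Ω] {d : ℕ} {x : Euc d}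
    {W : ℝ → Ω → Euc d} (hW : IsBrownianMotion x W) {s : ℝ} (hs : 0 ≤ s) :
    AEMeasurable (W s) := by
  rcases hs.eq_or_lt with rfl | hs
  · exact (measurable_const (a := x)).aemeasurable.congr (ae_of_all _ fun ω => (hW.1 ω).symm)
  by_contra hn
  have hmono : StrictMono fun _ : Fin 1 => s := Subsingleton.strictMono _
  have h := hW.2.2 0 (fun _ => s) hmono fun _ => hs
  rw [Measure.map_of_not_aemeasurable fun h' => hn (aemeasurable_pi_iff.1 h' 0),
    eq_comm, withDensity_eq_zero_iff] at h
  · obtain ⟨z, hz⟩ := h.exists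
    exact (ENNReal.ofReal_pos.2 (jointDensity_pos x hmono (fun _ => hs) z)).ne' hz
  · fun_prop

open Classical in
/-- A Brownian motion agrees almost surely, at all nonnegative times, with a jointly measurable
process. -/
theorem IsBrownianMotion.exists_measurable_version {Ω : Type*} [MeasureSpace Ω] {d : ℕ}
    {x : Euc d} {W : ℝ → Ω → Euc d} (hW : IsBrownianMotion x W) :
    ∃ X : ℝ → Ω → Euc d, Measurable (Function.uncurry X) ∧
      ∀ᵐ ω, ∀ s, 0 ≤ s → X s ω = W s ω := by
  have hmk (q : ℚ) : AEMeasurable (W |(q : ℝ)|) := hW.aemeasurable (abs_nonneg _)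
  have hae : ∀ᵐ ω, ∀ q : ℚ, W |(q : ℝ)| ω = (hmk q).mk _ ω :=
    ae_all_iff.2 fun q => (hmk q).ae_eq_mk
  obtain ⟨T, hT, hTm, hT0⟩ := exists_measurable_superset_of_null hae
  let X : ℝ → Ω → Euc d := fun s ω => if ω ∈ T then x else W |s| ω
  have hcont (ω : Ω) : Continuous fun s => X s ω := by
    by_cases h : ω ∈ T
    · simpa [X, h] using continuous_const
    · simp only [X, h, if_false]
      exact (hW.2.1 ω).comp continuous_abs
  have hrat (q : ℚ) : Measurable (X q) := by
    have : X q = T.piecewise (fun _ => x) ((hmk q).mk _) := by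
      ext1 ω
      by_cases h : ω ∈ T
      · simp [X, h]
      · simpa [X, h] using not_not.1 (fun h' => h (hT h')) q
    rw [this]
    exact measurable_const.piecewise hTm (hmk q).measurable_mk
  refine ⟨X, measurable_uncurry_of_continuous_of_measurable hcont fun s => ?_, ?_⟩
  · obtain ⟨q, hq, hlim⟩ := mem_closure_iff_seq_limit.1 (Rat.denseRange_cast (𝕜 := ℝ) s)
    refine measurable_of_tendsto_metrizable (f := fun n => X (q n)) (fun n => ?_)
      (tendsto_pi_nhds.2 fun ω => ((hcont ω).tendsto s).comp hlim)
    obtain ⟨p, hp⟩ := hq n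
    rw [← hp]
    exact hrat p
  · filter_upwards [measure_eq_zero_iff_ae_notMem.1 hT0] with ω hω s hs
    simp [X, hω, abs_of_nonneg hs]

/-- The expectation of `∏ i, f (W (s i))` for a Brownian motion `W` started at `x`, written through
the joint density. -/
def expectedProd {d k : ℕ} (f : Euc d → ENNReal) (x : Euc d) (s : Fin k → ℝ) : ENNReal :=
  ∫⁻ z : Fin k → Euc d, ENNReal.ofReal (jointDensity d x s z) * ∏ i, f (z i)

@[fun_prop]
theorem measurable_expectedProd {β : Type*} [MeasurableSpace β] {d k : ℕ} {f : Euc d → ENNReal}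
    (hf : Measurable f) {x : β → Euc d} {s : β → Fin k → ℝ} (hx : Measurable x)
    (hs : Measurable s) : Measurable fun b => expectedProd f (x b) (s b) := by
  unfold expectedProd
  refine Measurable.lintegral_prod_right' (f := fun p : β × (Fin k → Euc d) =>
    ENNReal.ofReal (jointDensity d (x p.1) (s p.1) p.2) * ∏ i, f (p.2 i)) ?_
  fun_prop

theorem expectedProd_cons {d k : ℕ} {f : Euc d → ENNReal} (hf : Measurable f) (x : Euc d)
    {u : ℝ} (hu : 0 < u) (r : Fin k → ℝ) :
    expectedProd f x (Fin.cons u fun i => u + r i : Fin (k + 1) → ℝ) =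
      ∫⁻ y, ENNReal.ofReal (heatKernel d u (y - x)) * f y * expectedProd f y r := by
  rw [expectedProd, lintegral_fin_cons]
  · refine lintegral_congr fun y => ?_
    rw [expectedProd, ← lintegral_const_mul]
    · refine lintegral_congr fun z => ?_
      rw [jointDensity_cons, ENNReal.ofReal_mul (heatKernel_pos d hu _).le, Fin.prod_univ_succ]
      simp only [Fin.cons_zero, Fin.cons_succ]
      ring
    · fun_prop
  · fun_prop

/-- The Green function of Brownian motion. -/
def greenFunction (d : ℕ) (w : Euc d) : ENNReal :=
  ∫⁻ u in Set.Ioi (0 : ℝ), ENNReal.ofReal (heatKernel d u w)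

theorem lintegral_increasingTimes_succ {k : ℕ} {F : (Fin (k + 1) → ℝ) → ENNReal}
    (hF : Measurable F) :
    ∫⁻ s in increasingTimes (k + 1) 0, F s =
      ∫⁻ u in Set.Ioi (0 : ℝ), ∫⁻ r in increasingTimes k 0, F (Fin.cons u fun i => u + r i) := by
  rw [← lintegral_indicator (measurableSet_increasingTimes _ _),
    lintegral_fin_cons (hF.indicator (measurableSet_increasingTimes _ _)),
    ← lintegral_indicator measurableSet_Ioi]
  refine lintegral_congr fun u => ?_
  rw [← lintegral_add_left_eq_self _ (fun _ => u)]
  change ∫⁻ r : Fin k → ℝ, (increasingTimes (k + 1) 0).indicator F (Fin.cons u fun i => u + r i) = _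
  by_cases hu : 0 < u
  · rw [Set.indicator_of_mem (show u ∈ Set.Ioi (0 : ℝ) from hu),
      ← lintegral_indicator (measurableSet_increasingTimes _ _)]
    refine lintegral_congr fun r => ?_
    by_cases hr : r ∈ increasingTimes k 0
    · rw [Set.indicator_of_mem hr, Set.indicator_of_mem
        (cons_mem_increasingTimes.2 ⟨hu, add_mem_increasingTimes.2 hr⟩)]
    · rw [Set.indicator_of_notMem hr, Set.indicator_of_notMem fun h =>
        hr (add_mem_increasingTimes.1 (cons_mem_increasingTimes.1 h).2)]
  · rw [Set.indicator_of_notMem (show u ∉ Set.Ioi (0 : ℝ) from hu)]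
    refine lintegral_eq_zero_of_ae_eq_zero (ae_of_all _ fun r => ?_)
    exact Set.indicator_of_notMem (fun h => hu (cons_mem_increasingTimes.1 h).1) _

theorem lintegral_expectedProd_succ {d : ℕ} {f : Euc d → ENNReal} (hf : Measurable f)
    (x : Euc d) (k : ℕ) :
    ∫⁻ s in increasingTimes (k + 1) 0, expectedProd f x s =
      ∫⁻ y, greenFunction d (y - x) *
        (f y * ∫⁻ r in increasingTimes k 0, expectedProd f y r) := by
  have hM : Measurable fun y => ∫⁻ r in increasingTimes k 0, expectedProd f y r :=
    Measurable.lintegral_prod_right' (f := fun p : Euc d × (Fin k → ℝ) => expectedProd f p.1 p.2)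
      (by fun_prop)
  have hinner : ∀ u ∈ Set.Ioi (0 : ℝ), ∫⁻ r in increasingTimes k 0,
      expectedProd f x (Fin.cons u fun i => u + r i : Fin (k + 1) → ℝ) =
      ∫⁻ y, ENNReal.ofReal (heatKernel d u (y - x)) *
        (f y * ∫⁻ r in increasingTimes k 0, expectedProd f y r) := by
    intro u hu
    simp_rw [expectedProd_cons hf x hu]
    rw [lintegral_lintegral_swap]
    · refine lintegral_congr fun y => ?_
      rw [lintegral_const_mul _ (by fun_prop), mul_assoc]
    · unfold Function.uncurry
      fun_prop
  rw [lintegral_increasingTimes_succ (by fun_prop), setLIntegral_congr_fun measurableSet_Ioi hinner,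
    lintegral_lintegral_swap]
  · refine lintegral_congr fun y => ?_
    rw [lintegral_mul_const _ (by fun_prop)]
    rfl
  · unfold Function.uncurry
    fun_prop

/-- `X` has the finite-dimensional distributions of a Brownian motion started at `x`. -/
def HasBrownianLaw {Ω : Type*} [MeasureSpace Ω] {d : ℕ} (x : Euc d) (X : ℝ → Ω → Euc d) : Prop :=
  ∀ (k : ℕ) (s : Fin (k + 1) → ℝ), StrictMono s → (∀ i, 0 < s i) →
    Measure.map (fun ω (i : Fin (k + 1)) => X (s i) ω) (ℙ : Measure Ω) =
      (volume : Measure (Fin (k + 1) → Euc d)).withDensity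
        (fun z => ENNReal.ofReal (jointDensity d x s z))

theorem HasBrownianLaw.lintegral_prod {Ω : Type*} [MeasureSpace Ω] {d : ℕ} {x : Euc d}
    {X : ℝ → Ω → Euc d} (hlaw : HasBrownianLaw x X) (hX : Measurable (Function.uncurry X))
    {f : Euc d → ENNReal} (hf : Measurable f) {k : ℕ} {s : Fin (k + 1) → ℝ}
    (hs : s ∈ increasingTimes (k + 1) 0) :
    ∫⁻ ω, ∏ i, f (X (s i) ω) = expectedProd f x s := by
  have hm : Measurable fun ω (i : Fin (k + 1)) => X (s i) ω :=
    measurable_pi_lambda _ fun i => hX.comp (measurable_const.prodMk measurable_id)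
  have hprod : Measurable fun z : Fin (k + 1) → Euc d => ∏ i, f (z i) :=
    Finset.measurable_prod _ fun i _ => hf.comp (measurable_pi_apply i)
  rw [← lintegral_map (f := fun z : Fin (k + 1) → Euc d => ∏ i, f (z i)) hprod hm,
    hlaw k s hs.1 hs.2, lintegral_withDensity_eq_lintegral_mul _ _ hprod]
  · rfl
  · fun_prop

/-- Kac's moment formula for the occupation integral `∫₀^∞ f(X_s) ds`, with the integration over
the first visited point singled out. -/
theorem HasBrownianLaw.lintegral_pow {Ω : Type*} [MeasureSpace Ω]
    [IsProbabilityMeasure (ℙ : Measure Ω)] {d : ℕ} {x : Euc d} {X : ℝ → Ω → Euc d}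
    (hlaw : HasBrownianLaw x X) (hX : Measurable (Function.uncurry X))
    {f : Euc d → ENNReal} (hf : Measurable f) (k : ℕ) :
    ∫⁻ ω, (∫⁻ s in Set.Ioi (0 : ℝ), f (X s ω)) ^ (k + 1) =
      (k + 1).factorial * ∫⁻ y, greenFunction d (y - x) *
        (f y * ∫⁻ r in increasingTimes k 0, expectedProd f y r) := by
  have hXs : ∀ ω, Measurable fun s => f (X s ω) := fun ω =>
    hf.comp (hX.comp (measurable_id.prodMk measurable_const))
  have hpow (ω : Ω) : (∫⁻ s in Set.Ioi (0 : ℝ), f (X s ω)) ^ (k + 1) =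
      (k + 1).factorial * ∫⁻ s in increasingTimes (k + 1) 0, ∏ i, f (X (s i) ω) := by
    rw [pow_lintegral_Ioi (hXs ω), iteratedTimeIntegral_eq (hXs ω)]
  simp_rw [hpow]
  rw [lintegral_const_mul' _ _ (ENNReal.natCast_ne_top _), lintegral_lintegral_swap,
    setLIntegral_congr_fun (measurableSet_increasingTimes _ _)
      fun s hs => hlaw.lintegral_prod hX hf hs, lintegral_expectedProd_succ hf]
  have hXi (i : Fin (k + 1)) : Measurable fun p : Ω × (Fin (k + 1) → ℝ) => X (p.2 i) p.1 :=
    hX.comp (g := Function.uncurry X) (f := fun p : Ω × (Fin (k + 1) → ℝ) => (p.2 i, p.1))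
      (by fun_prop)
  unfold Function.uncurry
  fun_prop

theorem heatKernel_mul_sq_le {d : ℕ} (hd : 3 ≤ d) {L : ℝ} (hL : 1 ≤ L) {w w' : Euc d}
    (hw : L * ‖w'‖ ≤ ‖w‖) {u : ℝ} (hu : 0 < u) :
    L ^ 2 * heatKernel d (L ^ 2 * u) w ≤ L⁻¹ * heatKernel d u w' := by
  have hL0 : 0 < L := by linarith
  have hd' : (3 : ℝ) ≤ d := by exact_mod_cast hd
  have hscale : (2 * π * (L ^ 2 * u)) ^ (-(d : ℝ) / 2) =
      L ^ (-(d : ℝ)) * (2 * π * u) ^ (-(d : ℝ) / 2) := by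
    rw [show 2 * π * (L ^ 2 * u) = L ^ 2 * (2 * π * u) by ring,
      Real.mul_rpow (by positivity) (by positivity), ← Real.rpow_natCast L 2,
      ← Real.rpow_mul hL0.le]
    congr 2
    push_cast
    ring
  have hpow : L ^ 2 * L ^ (-(d : ℝ)) ≤ L⁻¹ := by
    rw [← Real.rpow_natCast L 2, ← Real.rpow_add hL0, ← Real.rpow_neg_one]
    exact Real.rpow_le_rpow_of_exponent_le hL (by push_cast; linarith)
  have hexp : Real.exp (-‖w‖ ^ 2 / (2 * (L ^ 2 * u))) ≤ Real.exp (-‖w'‖ ^ 2 / (2 * u)) := by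
    have : (L * ‖w'‖) ^ 2 ≤ ‖w‖ ^ 2 := by gcongr
    rw [Real.exp_le_exp, div_le_div_iff₀ (by positivity) (by positivity)]
    nlinarith
  unfold heatKernel
  rw [hscale]
  calc L ^ 2 * (L ^ (-(d : ℝ)) * (2 * π * u) ^ (-(d : ℝ) / 2) *
        Real.exp (-‖w‖ ^ 2 / (2 * (L ^ 2 * u))))
      = (L ^ 2 * L ^ (-(d : ℝ))) * ((2 * π * u) ^ (-(d : ℝ) / 2) *
        Real.exp (-‖w‖ ^ 2 / (2 * (L ^ 2 * u)))) := by ring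
    _ ≤ _ := by gcongr

theorem lintegral_Ioi_comp_mul_left {c : ℝ} (hc : 0 < c) {h : ℝ → ENNReal} (hh : Measurable h) :
    ∫⁻ u in Set.Ioi (0 : ℝ), h u = ∫⁻ u in Set.Ioi (0 : ℝ), ENNReal.ofReal c * h (c * u) := by
  have hm : Measurable ((Set.Ioi (0 : ℝ)).indicator h) := hh.indicator measurableSet_Ioi
  have hmap : ∫⁻ u, (Set.Ioi (0 : ℝ)).indicator h u =
      ENNReal.ofReal c * ∫⁻ u, (Set.Ioi (0 : ℝ)).indicator h (c * u) := by
    conv_lhs => rw [← Real.smul_map_volume_mul_left hc.ne']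
    rw [lintegral_smul_measure, lintegral_map hm (measurable_const_mul c), abs_of_pos hc,
      smul_eq_mul]
  rw [← lintegral_indicator measurableSet_Ioi, ← lintegral_indicator measurableSet_Ioi, hmap,
    ← lintegral_const_mul _ (by fun_prop)]
  refine lintegral_congr fun u => ?_
  simp [Set.indicator, hc]

theorem greenFunction_le {d : ℕ} (hd : 3 ≤ d) {L : ℝ} (hL : 1 ≤ L) {w w' : Euc d}
    (hw : L * ‖w'‖ ≤ ‖w‖) :
    greenFunction d w ≤ ENNReal.ofReal L⁻¹ * greenFunction d w' := by
  have hL2 : 0 < L ^ 2 := by positivity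
  rw [greenFunction, lintegral_Ioi_comp_mul_left hL2 (by fun_prop), greenFunction,
    ← lintegral_const_mul _ (by fun_prop)]
  refine setLIntegral_mono' measurableSet_Ioi fun u hu => ?_
  rw [← ENNReal.ofReal_mul hL2.le, ← ENNReal.ofReal_mul (by positivity)]
  exact ENNReal.ofReal_le_ofReal (heatKernel_mul_sq_le hd hL hw hu)

theorem HasBrownianLaw.lintegral_le {Ω : Type*} [MeasureSpace Ω] {d : ℕ} {x : Euc d}
    {X : ℝ → Ω → Euc d} (hlaw : HasBrownianLaw x X) (hX : Measurable (Function.uncurry X))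
    {f : Euc d → ENNReal} (hf : Measurable f) {u : ℝ} (hu : 0 < u) :
    ∫⁻ ω, f (X u ω) ≤ ENNReal.ofReal ((2 * π * u) ^ (-(d : ℝ) / 2)) * ∫⁻ y, f y := by
  let r : Fin 0 → ℝ := Fin.elim0
  have hr : r ∈ increasingTimes 0 0 := ⟨Subsingleton.strictMono _, fun i => i.elim0⟩
  have h := hlaw.lintegral_prod hX hf
    (cons_mem_increasingTimes.2 ⟨hu, add_mem_increasingTimes.2 hr⟩)
  rw [expectedProd_cons hf x hu] at h
  have h1 (y : Euc d) : expectedProd f y r = 1 := by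
    simp [expectedProd, jointDensity, volume_pi]
  simp only [Fin.prod_univ_succ, Finset.univ_eq_empty, Finset.prod_empty, Fin.cons_zero, h1,
    mul_one] at h
  rw [h, ← lintegral_const_mul _ hf]
  refine lintegral_mono fun y => ?_
  gcongr
  unfold heatKernel
  refine mul_le_of_le_one_right (by positivity) (Real.exp_le_one_iff.2 ?_)
  exact div_nonpos_of_nonpos_of_nonneg (by simp) (by positivity)

theorem HasBrownianLaw.lintegral_occupation_ne_top {Ω : Type*} [MeasureSpace Ω]
    [IsProbabilityMeasure (ℙ : Measure Ω)] {d : ℕ} (hd : 3 ≤ d) {x : Euc d}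
    {X : ℝ → Ω → Euc d} (hlaw : HasBrownianLaw x X) (hX : Measurable (Function.uncurry X))
    {f : Euc d → ENNReal} (hf : Measurable f) {C : ENNReal} (hC : C ≠ ⊤) (hfC : ∀ y, f y ≤ C)
    (hfi : ∫⁻ y, f y ≠ ⊤) : ∫⁻ ω, ∫⁻ s in Set.Ioi (0 : ℝ), f (X s ω) ≠ ⊤ := by
  have hXm : Measurable fun p : Ω × ℝ => X p.2 p.1 := hX.comp measurable_swap
  have hd' : (3 : ℝ) ≤ d := by exact_mod_cast hd
  rw [lintegral_lintegral_swap (by unfold Function.uncurry; fun_prop),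
    ← Set.Ioc_union_Ioi_eq_Ioi zero_le_one, lintegral_union measurableSet_Ioi
      (Set.Ioc_disjoint_Ioi le_rfl)]
  refine ENNReal.add_ne_top.2 ⟨?_, ?_⟩
  · refine ne_top_of_le_ne_top hC ?_
    calc ∫⁻ s in Set.Ioc (0 : ℝ) 1, ∫⁻ ω, f (X s ω)
        ≤ ∫⁻ _ in Set.Ioc (0 : ℝ) 1, ∫⁻ _ : Ω, C :=
          lintegral_mono fun s => lintegral_mono fun ω => hfC _
      _ = C := by simp
  · have hint : IntegrableOn (fun u : ℝ => (2 * π) ^ (-(d : ℝ) / 2) * u ^ (-(d : ℝ) / 2))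
        (Set.Ioi 1) := (integrableOn_Ioi_rpow_of_lt (by linarith) one_pos).const_mul _
    refine ne_top_of_le_ne_top (ENNReal.mul_ne_top (Integrable.lintegral_lt_top hint).ne hfi) ?_
    rw [← lintegral_mul_const _ (by fun_prop)]
    refine setLIntegral_mono' measurableSet_Ioi fun u hu => ?_
    have hu0 : 0 < u := one_pos.trans hu
    rw [← Real.mul_rpow (by positivity) hu0.le]
    exact hlaw.lintegral_le hX hf hu0

theorem HasBrownianLaw.lintegral_pow_le {Ω : Type*} [MeasureSpace Ω]
    [IsProbabilityMeasure (ℙ : Measure Ω)] {d : ℕ} (hd : 3 ≤ d) {x : Euc d}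
    {X X₀ : ℝ → Ω → Euc d} (hlaw : HasBrownianLaw x X) (hX : Measurable (Function.uncurry X))
    (hlaw₀ : HasBrownianLaw 0 X₀) (hX₀ : Measurable (Function.uncurry X₀))
    {f : Euc d → ENNReal} (hf : Measurable f) {R : ℝ} (hfR : ∀ y, f y ≠ 0 → ‖y‖ ≤ R)
    {L : ℝ} (hL : 1 ≤ L) (hLx : L * R ≤ ‖x‖ - R) (k : ℕ) :
    ∫⁻ ω, (∫⁻ s in Set.Ioi (0 : ℝ), f (X s ω)) ^ (k + 1) ≤
      ENNReal.ofReal L⁻¹ * ∫⁻ ω, (∫⁻ s in Set.Ioi (0 : ℝ), f (X₀ s ω)) ^ (k + 1) := by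
  rw [hlaw.lintegral_pow hX hf, hlaw₀.lintegral_pow hX₀ hf, mul_left_comm,
    ← lintegral_const_mul' _ _ ENNReal.ofReal_ne_top]
  gcongr (k + 1).factorial * ?_
  refine lintegral_mono fun y => ?_
  by_cases hy : f y = 0
  · simp [hy]
  refine (mul_le_mul' (greenFunction_le (w' := y - 0) hd hL ?_) le_rfl).trans_eq
    (mul_assoc _ _ _)
  have h1 := hfR y hy
  have h2 := norm_sub_norm_le x y
  rw [norm_sub_rev] at h2
  rw [sub_zero]
  nlinarith

theorem tsum_ofReal_mul_pow {b : ℝ} (hb : 0 ≤ b) {A : ENNReal} (hA : A ≠ ⊤) :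
    ∑' k : ℕ, ENNReal.ofReal (b ^ (k + 1) / (k + 1).factorial) * A ^ (k + 1) =
      ENNReal.ofReal (Real.exp (b * A.toReal) - 1) := by
  have h : HasSum (fun k : ℕ => (b * A.toReal) ^ (k + 1) / (k + 1).factorial)
      (Real.exp (b * A.toReal) - 1) := by
    have := (hasSum_nat_add_iff' 1).2 (NormedSpace.expSeries_div_hasSum_exp (b * A.toReal))
    simpa [← Real.exp_eq_exp_ℝ] using this
  rw [← h.tsum_eq, ENNReal.ofReal_tsum_of_nonneg (fun k => by positivity) h.summable]
  refine tsum_congr fun k => ?_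
  conv_lhs => rw [← ENNReal.ofReal_toReal hA]
  rw [← ENNReal.ofReal_pow ENNReal.toReal_nonneg, ← ENNReal.ofReal_mul (by positivity), mul_pow]
  congr 1
  ring

theorem HasBrownianLaw.lintegral_exp_sub_one_le {Ω : Type*} [MeasureSpace Ω]
    [IsProbabilityMeasure (ℙ : Measure Ω)] {d : ℕ} (hd : 3 ≤ d) {x : Euc d}
    {X X₀ : ℝ → Ω → Euc d} (hlaw : HasBrownianLaw x X) (hX : Measurable (Function.uncurry X))
    (hlaw₀ : HasBrownianLaw 0 X₀) (hX₀ : Measurable (Function.uncurry X₀))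
    {f : Euc d → ENNReal} (hf : Measurable f) {R : ℝ} (hfR : ∀ y, f y ≠ 0 → ‖y‖ ≤ R)
    (hfin : ∀ᵐ ω, ∫⁻ s in Set.Ioi (0 : ℝ), f (X s ω) ≠ ⊤)
    (hfin₀ : ∀ᵐ ω, ∫⁻ s in Set.Ioi (0 : ℝ), f (X₀ s ω) ≠ ⊤)
    {L : ℝ} (hL : 1 ≤ L) (hLx : L * R ≤ ‖x‖ - R) {b : ℝ} (hb : 0 ≤ b) :
    ∫⁻ ω, ENNReal.ofReal (Real.exp (b * (∫⁻ s in Set.Ioi (0 : ℝ), f (X s ω)).toReal) - 1) ≤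
      ENNReal.ofReal L⁻¹ * ∫⁻ ω,
        ENNReal.ofReal (Real.exp (b * (∫⁻ s in Set.Ioi (0 : ℝ), f (X₀ s ω)).toReal) - 1) := by
  have expand {Y : ℝ → Ω → Euc d} (hY : Measurable (Function.uncurry Y))
      (hYfin : ∀ᵐ ω, ∫⁻ s in Set.Ioi (0 : ℝ), f (Y s ω) ≠ ⊤) :
      ∫⁻ ω, ENNReal.ofReal (Real.exp (b * (∫⁻ s in Set.Ioi (0 : ℝ), f (Y s ω)).toReal) - 1) =
        ∑' k : ℕ, ENNReal.ofReal (b ^ (k + 1) / (k + 1).factorial) *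
          ∫⁻ ω, (∫⁻ s in Set.Ioi (0 : ℝ), f (Y s ω)) ^ (k + 1) := by
    have hYm : Measurable fun p : Ω × ℝ => f (Y p.2 p.1) := hf.comp (hY.comp measurable_swap)
    have hA : Measurable fun ω => ∫⁻ s in Set.Ioi (0 : ℝ), f (Y s ω) := hYm.lintegral_prod_right'
    simp_rw [← lintegral_const_mul' _ _ ENNReal.ofReal_ne_top]
    rw [← lintegral_tsum fun k => by fun_prop]
    exact lintegral_congr_ae (hYfin.mono fun ω hω => (tsum_ofReal_mul_pow hb hω).symm)
  rw [expand hX hfin, expand hX₀ hfin₀, ← ENNReal.tsum_mul_left]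
  refine ENNReal.tsum_le_tsum fun k => ?_
  rw [mul_left_comm]
  gcongr
  exact hlaw.lintegral_pow_le hd hX hlaw₀ hX₀ hf hfR hL hLx k

theorem abs_exp_sub_one_le_exp_abs_sub_one (y : ℝ) : |Real.exp y - 1| ≤ Real.exp |y| - 1 := by
  rcases le_total 0 y with h | h
  · rw [abs_of_nonneg h, abs_of_nonneg (by linarith [Real.one_le_exp h])]
  · rw [abs_of_nonpos h, abs_of_nonpos (by linarith [Real.exp_le_one_iff.2 h])]
    have h1 : Real.exp y * Real.exp (-y) = 1 := by rw [← Real.exp_add]; simp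
    nlinarith [Real.exp_pos y, Real.exp_pos (-y), sq_nonneg (Real.exp y - 1),
      sq_nonneg (Real.exp (-y) - 1)]

theorem IsBrownianMotion.hasBrownianLaw {Ω : Type*} [MeasureSpace Ω] {d : ℕ} {x : Euc d}
    {W X : ℝ → Ω → Euc d} (hW : IsBrownianMotion x W) (hXW : ∀ᵐ ω, ∀ s, 0 ≤ s → X s ω = W s ω) :
    HasBrownianLaw x X := by
  intro k s hs hs0
  rw [← hW.2.2 k s hs hs0]
  exact Measure.map_congr (hXW.mono fun ω h => funext fun i => h _ (hs0 i).le)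

/-- The exponential moment of a path integral is within an arbitrarily small multiple of a fixed
exponential moment from `1`, once the starting point is far away from the support. -/
theorem IsBrownianMotion.integrable_and_lintegral_exp_pathInt_le {Ω : Type*} [MeasureSpace Ω]
    [IsProbabilityMeasure (ℙ : Measure Ω)] {d : ℕ} (hd : 3 ≤ d) {v : Euc d → ℝ}
    (hvm : Measurable v) {C : ℝ} (hvb : ∀ z, |v z| ≤ C) {R : ℝ} (hvs : ∀ z, v z ≠ 0 → ‖z‖ ≤ R)
    {x : Euc d} {W W₀ : ℝ → Ω → Euc d} (hW : IsBrownianMotion x W) (hW₀ : IsBrownianMotion 0 W₀)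
    {L : ℝ} (hL : 1 ≤ L) (hLx : L * R ≤ ‖x‖ - R) (α t : ℝ) :
    AEStronglyMeasurable (fun ω => Real.exp (α * pathInt v W t ω)) ∧
    ∫⁻ ω, ‖Real.exp (α * pathInt v W t ω) - 1‖ₑ ≤ ENNReal.ofReal L⁻¹ *
      ∫⁻ ω, ENNReal.ofReal (Real.exp (|α| * ∫ s in Set.Ioi (0 : ℝ), |v (W₀ s ω)|)) := by
  obtain ⟨X, hX, hXW⟩ := hW.exists_measurable_version
  obtain ⟨X₀, hX₀, hXW₀⟩ := hW₀.exists_measurable_version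
  have hlaw := hW.hasBrownianLaw hXW
  have hlaw₀ := hW₀.hasBrownianLaw hXW₀
  set f : Euc d → ENNReal := fun z => ‖v z‖ₑ
  have hf : Measurable f := hvm.enorm
  have hfR : ∀ y, f y ≠ 0 → ‖y‖ ≤ R := fun y hy => hvs y (by simpa [f] using hy)
  have hfC : ∀ y, f y ≤ ENNReal.ofReal C := fun y => by
    rw [show f y = ‖v y‖ₑ from rfl, Real.enorm_eq_ofReal_abs]
    exact ENNReal.ofReal_le_ofReal (hvb y)
  have hfi : ∫⁻ y, f y ≠ ⊤ := by
    have h : ∫⁻ y, f y = ∫⁻ y in Metric.closedBall 0 R, f y := by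
      refine (setLIntegral_eq_of_support_subset ?_).symm
      exact fun y hy => by simpa using hfR y hy
    rw [h]
    refine ne_top_of_le_ne_top (ENNReal.mul_ne_top ENNReal.ofReal_ne_top
      (measure_closedBall_lt_top (μ := volume) (x := (0 : Euc d)) (r := R)).ne)
      ((lintegral_mono hfC).trans_eq (setLIntegral_const _ _))
  have finite {a : Euc d} {Y : ℝ → Ω → Euc d} (hY : Measurable (Function.uncurry Y))
      (hYl : HasBrownianLaw a Y) : ∀ᵐ ω, ∫⁻ s in Set.Ioi (0 : ℝ), f (Y s ω) ≠ ⊤ := by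
    have hYm : Measurable fun p : Ω × ℝ => f (Y p.2 p.1) := hf.comp (hY.comp measurable_swap)
    have hA : Measurable fun ω => ∫⁻ s in Set.Ioi (0 : ℝ), f (Y s ω) := hYm.lintegral_prod_right'
    exact (ae_lt_top hA (hYl.lintegral_occupation_ne_top hd hY hf ENNReal.ofReal_ne_top hfC
      hfi)).mono fun ω h => h.ne
  have hfin := finite hX hlaw
  have hfin₀ := finite hX₀ hlaw₀
  constructor
  · have hXm : Measurable fun p : Ω × ℝ => v (X p.2 p.1) := hvm.comp (hX.comp measurable_swap)
    have hY : StronglyMeasurable fun ω => pathInt v X t ω :=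
      hXm.stronglyMeasurable.integral_prod_right'
    have hexp : Measurable fun ω => Real.exp (α * pathInt v X t ω) :=
      (hY.measurable.const_mul α).exp
    refine hexp.aestronglyMeasurable.congr (hXW.mono fun ω h => ?_)
    have : pathInt v X t ω = pathInt v W t ω :=
      setIntegral_congr_fun measurableSet_Ioc fun s hs => by simp only [h s hs.1.le]
    simp only [this]
  · calc ∫⁻ ω, ‖Real.exp (α * pathInt v W t ω) - 1‖ₑ
        ≤ ∫⁻ ω, ENNReal.ofReal
            (Real.exp (|α| * (∫⁻ s in Set.Ioi (0 : ℝ), f (X s ω)).toReal) - 1) := by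
          refine lintegral_mono_ae ?_
          filter_upwards [hXW, hfin] with ω h hω
          rw [Real.enorm_eq_ofReal_abs]
          refine ENNReal.ofReal_le_ofReal ((abs_exp_sub_one_le_exp_abs_sub_one _).trans ?_)
          rw [abs_mul]
          gcongr
          rw [← Real.norm_eq_abs, ← toReal_enorm]
          refine ENNReal.toReal_mono hω ((enorm_integral_le_lintegral_enorm _).trans ?_)
          rw [setLIntegral_congr_fun (g := fun s => f (W s ω)) measurableSet_Ioi
            fun s (hs : 0 < s) => by simp only [h s hs.le]]
          exact lintegral_mono_set Set.Ioc_subset_Ioi_self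
      _ ≤ ENNReal.ofReal L⁻¹ * ∫⁻ ω, ENNReal.ofReal
            (Real.exp (|α| * (∫⁻ s in Set.Ioi (0 : ℝ), f (X₀ s ω)).toReal) - 1) :=
          hlaw.lintegral_exp_sub_one_le hd hX hlaw₀ hX₀ hf hfR hfin hfin₀ hL hLx (abs_nonneg α)
      _ ≤ _ := by
          gcongr ENNReal.ofReal L⁻¹ * ?_
          refine lintegral_mono_ae (hXW₀.mono fun ω h => ENNReal.ofReal_le_ofReal ?_)
          have hm : Measurable fun s => v (W₀ s ω) := hvm.comp (hW₀.2.1 ω).measurable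
          have he : ∫ s in Set.Ioi (0 : ℝ), |v (W₀ s ω)| =
              (∫⁻ s in Set.Ioi (0 : ℝ), f (X₀ s ω)).toReal := by
            simp_rw [← Real.norm_eq_abs]
            rw [integral_norm_eq_lintegral_enorm hm.aestronglyMeasurable]
            congr 1
            exact setLIntegral_congr_fun measurableSet_Ioi
              fun s (hs : 0 < s) => by simp only [f, h s hs.le]
          rw [he]
          linarith

/-- Lemma 4(b): if the starting points escape to infinity, the m.g.f. of the truncated
path integral converges to `1`. -/
theorem stmt9 (d : ℕ) (hd : 3 ≤ d) (v : Euc d → ℝ)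
    (hvm : Measurable v) (hvb : ∃ C : ℝ, ∀ z, |v z| ≤ C)
    (hvs : ∃ R : ℝ, ∀ z, v z ≠ 0 → ‖z‖ ≤ R)
    {Ω : Type*} [MeasureSpace Ω] [IsProbabilityMeasure (ℙ : Measure Ω)]
    (W : Euc d → ℝ → Ω → Euc d) (hW : ∀ a, IsBrownianMotion a (W a))
    (α₀ : ℝ) (hα₀ : 0 < α₀)
    (hexp : ∀ (a : Euc d) (α : ℝ), |α| < α₀ →
      (∫⁻ ω, ENNReal.ofReal (Real.exp (α * ∫ s in Set.Ioi (0 : ℝ), |v (W a s ω)|))) ≠ ⊤)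
    (x : ℕ → Euc d) (t : ℕ → ℝ)
    (hx : Tendsto (fun n => ‖x n‖) atTop atTop) (ht : Tendsto t atTop atTop) :
    ∀ α : ℝ, |α| < α₀ →
      Tendsto (fun n => ∫ ω, Real.exp (α * pathInt v (W (x n)) (t n) ω)) atTop (𝓝 1) := by
  obtain ⟨C, hC⟩ := hvb
  obtain ⟨R', hR'⟩ := hvs
  intro α hα
  set R : ℝ := max R' 1
  have hR : 0 < R := lt_max_of_lt_right one_pos
  have hvR : ∀ z, v z ≠ 0 → ‖z‖ ≤ R := fun z hz => (hR' z hz).trans (le_max_left _ _)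
  set K : ENNReal :=
    ∫⁻ ω, ENNReal.ofReal (Real.exp (|α| * ∫ s in Set.Ioi (0 : ℝ), |v (W 0 s ω)|))
  have hK : K ≠ ⊤ := hexp 0 |α| (by rwa [abs_abs])
  set L : ℕ → ℝ := fun n => (‖x n‖ - R) / R
  have hL : Tendsto L atTop atTop :=
    (tendsto_atTop_add_const_right _ (-R) hx).atTop_div_const hR
  have hlim : Tendsto (fun n => (L n)⁻¹ * K.toReal) atTop (𝓝 0) := by
    simpa using (tendsto_inv_atTop_zero.comp hL).mul_const K.toReal
  rw [tendsto_iff_norm_sub_tendsto_zero]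
  refine squeeze_zero' (Eventually.of_forall fun n => norm_nonneg _) ?_ hlim
  filter_upwards [hL.eventually_ge_atTop 1] with n hn
  obtain ⟨hmeas, hle⟩ := (hW (x n)).integrable_and_lintegral_exp_pathInt_le hd hvm hC hvR
    (hW 0) hn (div_mul_cancel₀ _ hR.ne').le α (t n)
  have htop : ENNReal.ofReal (L n)⁻¹ * K ≠ ⊤ := ENNReal.mul_ne_top ENNReal.ofReal_ne_top hK
  have hint : Integrable fun ω => Real.exp (α * pathInt v (W (x n)) (t n) ω) - 1 :=
    ⟨hmeas.sub aestronglyMeasurable_const, hle.trans_lt htop.lt_top⟩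
  have hint' : Integrable fun ω => Real.exp (α * pathInt v (W (x n)) (t n) ω) := 
    (hint.add (integrable_const 1)).congr (ae_of_all _ fun ω => sub_add_cancel _ _)
  have heq : (∫ ω, Real.exp (α * pathInt v (W (x n)) (t n) ω)) - 1 =
      ∫ ω, (Real.exp (α * pathInt v (W (x n)) (t n) ω) - 1) := by
    rw [integral_sub hint' (integrable_const 1)]
    simp
  rw [heq, ← toReal_enorm, ← ENNReal.toReal_ofReal (inv_nonneg.2 (zero_le_one.trans hn)),
    ← ENNReal.toReal_mul]
  exact ENNReal.toReal_mono htop ((enorm_integral_le_lintegral_enorm _).trans hle)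

end
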